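/- Fix an integer d ≥ 2. For every z > 0, the function H satisfies the strict inequalities d/2 + 1 < H(z) < d + 1. Equivalently, the dimensionless heat capacities of a relativistic ideal gas in d spatial dimensions satisfy d/2 + 1 < c_p/k_B < d + 1 and d/2 < c_v/k_B < d at every temperature. -/

import Mathlib

open MeasureTheory Real Filter

/-- The modified Bessel function of the second kind, defined via its integral
representation `K_ν(z) = ∫_0^∞ exp(−z cosh t) cosh(ν t) dt`. -/
noncomputable def besselK (ν z : ℝ) : ℝ :=
  ∫ t in Set.Ioi (0:ℝ), Real.exp (-z * Real.cosh t) * Real.cosh (ν * t)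

/-- The ratio `G_k(z) = K_{(d+1)/2+k}(z) / K_{(d+1)/2}(z)`. -/
noncomputable def G (d k : ℤ) (z : ℝ) : ℝ :=
  besselK (((d : ℝ) + 1) / 2 + (k : ℝ)) z / besselK (((d : ℝ) + 1) / 2) z

/-- `H(z) = −z² G_1′(z)`; physically `H(z) = c_p/k_B` is the dimensionless heat
capacity per particle at constant pressure, and `H(z) − 1 = c_v/k_B`. -/
noncomputable def Hfun (d : ℤ) (z : ℝ) : ℝ := -z ^ 2 * deriv (G d 1) z

theorem one_add_sq_div_two_le_cosh (t : ℝ) : 1 + t ^ 2 / 2 ≤ Real.cosh t := by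
  have h1 : (t / 2) ^ 2 ≤ Real.sinh (t / 2) ^ 2 := by
    rw [sq_le_sq, Real.abs_sinh]
    exact Real.self_le_sinh_iff.2 (abs_nonneg _)
  have h2 := Real.cosh_two_mul (t / 2)
  rw [mul_div_cancel₀ t two_ne_zero, Real.cosh_sq] at h2
  linarith

/-- The weight `exp (-z cosh t)` beats every exponential. -/
theorem exp_neg_mul_cosh_mul_exp_le {z : ℝ} (hz : 0 < z) (a t : ℝ) :
    Real.exp (-z * Real.cosh t) * Real.exp (a * t) ≤
      Real.exp ((a + 1) ^ 2 / (2 * z)) * Real.exp (-t) := by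
  rw [← Real.exp_add, ← Real.exp_add, Real.exp_le_exp]
  have hc : t ^ 2 / 2 ≤ Real.cosh t := by
    have := one_add_sq_div_two_le_cosh t
    linarith
  have h1 : z * (t ^ 2 / 2) ≤ z * Real.cosh t := mul_le_mul_of_nonneg_left hc hz.le
  have h2 : (a + 1) ^ 2 / (2 * z) - (a + 1) * t + z * (t ^ 2 / 2) =
      (a + 1 - z * t) ^ 2 / (2 * z) := by
    field_simp
    ring
  have h3 : 0 ≤ (a + 1 - z * t) ^ 2 / (2 * z) := by positivity
  linarith

theorem integrableOn_exp_neg_mul_cosh_mul_exp {z : ℝ} (hz : 0 < z) (a : ℝ) :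
    IntegrableOn (fun t => Real.exp (-z * Real.cosh t) * Real.exp (a * t)) (Set.Ioi 0) := by
  refine Integrable.mono'
    ((integrableOn_exp_neg_Ioi 0).const_mul (Real.exp ((a + 1) ^ 2 / (2 * z)))) ?_ ?_
  · exact (by fun_prop : Continuous fun t : ℝ =>
      Real.exp (-z * Real.cosh t) * Real.exp (a * t)).aestronglyMeasurable
  · refine Eventually.of_forall fun t => ?_
    rw [Real.norm_of_nonneg (by positivity)]
    exact exp_neg_mul_cosh_mul_exp_le hz a t

theorem integrableOn_besselK {z : ℝ} (hz : 0 < z) (ν : ℝ) :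
    IntegrableOn (fun t => Real.exp (-z * Real.cosh t) * Real.cosh (ν * t)) (Set.Ioi 0) := by
  have h := ((integrableOn_exp_neg_mul_cosh_mul_exp hz ν).add
    (integrableOn_exp_neg_mul_cosh_mul_exp hz (-ν))).div_const 2
  refine h.congr (Eventually.of_forall fun t => ?_)
  simp only [Pi.add_apply, Real.cosh_eq (ν * t), neg_mul]
  ring

theorem cosh_mul_cosh_eq (ν t : ℝ) : Real.cosh t * Real.cosh (ν * t) =
    (Real.cosh ((ν + 1) * t) + Real.cosh ((ν - 1) * t)) / 2 := by
  rw [add_mul, sub_mul, one_mul, Real.cosh_add, Real.cosh_sub]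
  ring

theorem sinh_mul_sinh_eq (ν t : ℝ) : Real.sinh t * Real.sinh (ν * t) =
    (Real.cosh ((ν + 1) * t) - Real.cosh ((ν - 1) * t)) / 2 := by
  rw [add_mul, sub_mul, one_mul, Real.cosh_add, Real.cosh_sub]
  ring

theorem integrableOn_cosh_mul_besselK {z : ℝ} (hz : 0 < z) (ν : ℝ) :
    IntegrableOn (fun t => Real.exp (-z * Real.cosh t) * (Real.cosh t * Real.cosh (ν * t)))
      (Set.Ioi 0) := by
  refine (((integrableOn_besselK hz (ν + 1)).add
    (integrableOn_besselK hz (ν - 1))).div_const 2).congr (Eventually.of_forall fun t => ?_)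
  simp only [Pi.add_apply, cosh_mul_cosh_eq]
  ring

theorem integral_cosh_mul_besselK {z : ℝ} (hz : 0 < z) (ν : ℝ) :
    ∫ t in Set.Ioi (0 : ℝ), Real.exp (-z * Real.cosh t) * (Real.cosh t * Real.cosh (ν * t)) =
      (besselK (ν + 1) z + besselK (ν - 1) z) / 2 := by
  unfold besselK
  rw [← integral_add (integrableOn_besselK hz (ν + 1)) (integrableOn_besselK hz (ν - 1)),
    ← integral_div]
  congr 1 with t
  rw [cosh_mul_cosh_eq]
  ring

theorem setIntegral_Ioi_pos {f : ℝ → ℝ} (hf : IntegrableOn f (Set.Ioi 0))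
    (h0 : ∀ t, 0 < t → 0 ≤ f t) {s : ℝ} (hpos : ∀ t, 0 < t → t ≠ s → 0 < f t) :
    0 < ∫ t in Set.Ioi (0 : ℝ), f t := by
  rw [setIntegral_pos_iff_support_of_nonneg_ae
    ((ae_restrict_iff' measurableSet_Ioi).2 (Eventually.of_forall h0)) hf]
  have hsub : Set.Ioi (max 0 s) ⊆ Function.support f ∩ Set.Ioi 0 := fun t ht => by
    have ht' := max_lt_iff.1 (Set.mem_Ioi.1 ht)
    exact ⟨(hpos t ht'.1 ht'.2.ne').ne', ht'.1⟩
  refine lt_of_lt_of_le ?_ (measure_mono hsub)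
  simp

theorem besselK_pos {z : ℝ} (hz : 0 < z) (ν : ℝ) : 0 < besselK ν z := by
  have h : ∀ t, 0 < Real.exp (-z * Real.cosh t) * Real.cosh (ν * t) := fun t =>
    mul_pos (Real.exp_pos _) (Real.cosh_pos _)
  exact setIntegral_Ioi_pos (s := 0) (integrableOn_besselK hz ν) (fun t _ => (h t).le)
    fun t _ _ => h t

theorem hasDerivAt_besselK_neighbors {z : ℝ} (hz : 0 < z) (ν : ℝ) :
    HasDerivAt (besselK ν) (-((besselK (ν + 1) z + besselK (ν - 1) z) / 2)) z := by
  have hz2 : 0 < z / 2 := by positivity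
  have key := hasDerivAt_integral_of_dominated_loc_of_deriv_le
    (μ := volume.restrict (Set.Ioi (0 : ℝ))) (x₀ := z) (s := Set.Ioi (z / 2))
    (F := fun z t => Real.exp (-z * Real.cosh t) * Real.cosh (ν * t))
    (F' := fun z t => -(Real.exp (-z * Real.cosh t) * (Real.cosh t * Real.cosh (ν * t))))
    (bound := fun t => Real.exp (-(z / 2) * Real.cosh t) * (Real.cosh t * Real.cosh (ν * t)))
    (Ioi_mem_nhds (by linarith))
    (Eventually.of_forall fun y => (by fun_prop : Continuous fun t : ℝ =>
      Real.exp (-y * Real.cosh t) * Real.cosh (ν * t)).aestronglyMeasurable)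
    (integrableOn_besselK hz ν)
    (by fun_prop : Continuous fun t : ℝ =>
      -(Real.exp (-z * Real.cosh t) * (Real.cosh t * Real.cosh (ν * t)))).aestronglyMeasurable
    (Eventually.of_forall fun t y hy => by
      have h1 := Real.cosh_pos t
      have h2 := Real.cosh_pos (ν * t)
      rw [norm_neg, Real.norm_of_nonneg (by positivity)]
      have hy' : z / 2 < y := hy
      gcongr)
    (integrableOn_cosh_mul_besselK hz2 ν)
    (Eventually.of_forall fun t y _ => by
      have h := (((hasDerivAt_id y).neg.mul_const (Real.cosh t)).exp).mul_const
        (Real.cosh (ν * t))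
      refine h.congr_deriv ?_
      simp only [Pi.neg_apply, id]
      ring)
  have h := key.2
  rw [integral_neg, integral_cosh_mul_besselK hz] at h
  exact h

theorem tendsto_exp_neg_mul_cosh_mul_sinh {z : ℝ} (hz : 0 < z) (ν : ℝ) :
    Tendsto (fun t => Real.exp (-z * Real.cosh t) * Real.sinh (ν * t)) atTop (nhds 0) := by
  have h : ∀ a : ℝ, Tendsto (fun t => Real.exp (-z * Real.cosh t) * Real.exp (a * t)) atTop
      (nhds 0) := fun a => by
    refine squeeze_zero (fun t => by positivity) (exp_neg_mul_cosh_mul_exp_le hz a) ?_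
    simpa using (Real.tendsto_exp_neg_atTop_nhds_zero).const_mul
      (Real.exp ((a + 1) ^ 2 / (2 * z)))
  have h2 := ((h ν).sub (h (-ν))).div_const 2
  simp only [sub_zero, zero_div] at h2
  refine h2.congr fun t => ?_
  rw [Real.sinh_eq (ν * t), neg_mul ν t]
  ring

theorem besselK_recurrence {z : ℝ} (hz : 0 < z) (ν : ℝ) :
    z * (besselK (ν + 1) z - besselK (ν - 1) z) = 2 * ν * besselK ν z := by
  have hi := (((integrableOn_besselK hz (ν + 1)).sub
    (integrableOn_besselK hz (ν - 1))).const_mul (-z / 2)).add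
    ((integrableOn_besselK hz ν).const_mul ν)
  have key := integral_Ioi_of_hasDerivAt_of_tendsto' (a := 0)
    (f := fun t => Real.exp (-z * Real.cosh t) * Real.sinh (ν * t)) (fun t _ => by
      have h := (((Real.hasDerivAt_cosh t).const_mul (-z)).exp).mul
        (((hasDerivAt_id t).const_mul ν).sinh)
      refine h.congr_deriv (f' := _) (g' := -z / 2 *
        (Real.exp (-z * Real.cosh t) * Real.cosh ((ν + 1) * t) -
          Real.exp (-z * Real.cosh t) * Real.cosh ((ν - 1) * t)) +
        ν * (Real.exp (-z * Real.cosh t) * Real.cosh (ν * t))) ?_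
      simp only [id]
      linear_combination -z * Real.exp (-z * Real.cosh t) * sinh_mul_sinh_eq ν t)
    hi (tendsto_exp_neg_mul_cosh_mul_sinh hz ν)
  rw [integral_add' (((integrableOn_besselK hz (ν + 1)).sub
    (integrableOn_besselK hz (ν - 1))).const_mul (-z / 2))
    ((integrableOn_besselK hz ν).const_mul ν), integral_const_mul, integral_const_mul,
    integral_sub' (integrableOn_besselK hz (ν + 1)) (integrableOn_besselK hz (ν - 1))] at key
  simp only [mul_zero, Real.sinh_zero, sub_zero] at key
  change -z / 2 * (besselK (ν + 1) z - besselK (ν - 1) z) + ν * besselK ν z = 0 at key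
  linarith

theorem hasDerivAt_besselK {z : ℝ} (hz : 0 < z) (ν : ℝ) :
    HasDerivAt (besselK ν) (-besselK (ν + 1) z + ν / z * besselK ν z) z := by
  refine (hasDerivAt_besselK_neighbors hz ν).congr_deriv ?_
  have h := besselK_recurrence hz ν
  field_simp
  linarith

theorem hasDerivAt_besselK_succ {z : ℝ} (hz : 0 < z) (ν : ℝ) :
    HasDerivAt (besselK (ν + 1)) (-besselK ν z - (ν + 1) / z * besselK (ν + 1) z) z := by
  refine (hasDerivAt_besselK_neighbors hz (ν + 1)).congr_deriv ?_
  have h := besselK_recurrence hz (ν + 1)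
  rw [add_sub_cancel_right] at h ⊢
  field_simp
  linarith

/-- The Riccati equation for the ratio of consecutive Bessel functions. -/
theorem hasDerivAt_besselK_ratio {z : ℝ} (hz : 0 < z) (ν : ℝ) :
    HasDerivAt (fun y => besselK (ν + 1) y / besselK ν y)
      ((besselK (ν + 1) z / besselK ν z) ^ 2
        - (2 * ν + 1) / z * (besselK (ν + 1) z / besselK ν z) - 1) z := by
  have hK := besselK_pos hz ν
  refine ((hasDerivAt_besselK_succ hz ν).div (hasDerivAt_besselK hz ν) hK.ne').congr_deriv ?_
  field_simp
  ring

/-- `cosh ((μ + 1) t) / cosh (μ t)` is strictly increasing, in cross-multiplied form. -/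
theorem cosh_succ_mul_lt {μ s t : ℝ} (hμ : 0 ≤ μ) (hs : 0 ≤ s) (hst : s < t) :
    Real.cosh ((μ + 1) * s) * Real.cosh (μ * t) <
      Real.cosh ((μ + 1) * t) * Real.cosh (μ * s) := by
  have hms : 0 ≤ μ * s := by positivity
  have hmst : μ * s ≤ μ * t := by gcongr
  have h1 : Real.cosh ((μ + 1) * s + μ * t) < Real.cosh ((μ + 1) * t + μ * s) := by
    rw [Real.cosh_lt_cosh, abs_of_nonneg (by nlinarith), abs_of_nonneg (by nlinarith)]
    nlinarith
  have h2 : Real.cosh ((μ + 1) * s - μ * t) < Real.cosh ((μ + 1) * t - μ * s) := by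
    rw [Real.cosh_lt_cosh, abs_of_nonneg (a := (μ + 1) * t - μ * s) (by nlinarith), abs_lt]
    constructor <;> nlinarith
  rw [Real.cosh_add, Real.cosh_add] at h1
  rw [Real.cosh_sub, Real.cosh_sub] at h2
  linarith

theorem cosh_mul_lt_cosh_succ_mul {μ t : ℝ} (hμ : 0 ≤ μ) (ht : 0 < t) :
    Real.cosh (μ * t) < Real.cosh ((μ + 1) * t) := by
  rw [Real.cosh_lt_cosh, abs_of_nonneg (by positivity), abs_of_nonneg (by positivity)]
  linarith

theorem besselK_lt_besselK_succ {z μ : ℝ} (hz : 0 < z) (hμ : 0 ≤ μ) :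
    besselK μ z < besselK (μ + 1) z := by
  have h : ∀ t, 0 < t → 0 < Real.exp (-z * Real.cosh t) * Real.cosh ((μ + 1) * t) -
      Real.exp (-z * Real.cosh t) * Real.cosh (μ * t) := fun t ht => by
    rw [← mul_sub]
    exact mul_pos (Real.exp_pos _) (sub_pos.2 (cosh_mul_lt_cosh_succ_mul hμ ht))
  have := setIntegral_Ioi_pos (s := 0)
    ((integrableOn_besselK hz (μ + 1)).sub (integrableOn_besselK hz μ))
    (fun t ht => (h t ht).le) fun t ht _ => h t ht
  rw [integral_sub' (integrableOn_besselK hz (μ + 1)) (integrableOn_besselK hz μ)] at this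
  exact sub_pos.1 this

theorem exists_cosh_succ_mul_eq {μ r : ℝ} (hr : 1 ≤ r) (hμ : 0 ≤ μ) :
    ∃ s, 0 ≤ s ∧ Real.cosh ((μ + 1) * s) = r * Real.cosh (μ * s) := by
  have hr0 : 0 ≤ r := by linarith
  have hcont : ContinuousOn
      (fun s => Real.cosh ((μ + 1) * s) - r * Real.cosh (μ * s)) (Set.Icc 0 (2 * r)) := by
    fun_prop
  have hmem : (0 : ℝ) ∈ Set.Icc (Real.cosh ((μ + 1) * 0) - r * Real.cosh (μ * 0))
      (Real.cosh ((μ + 1) * (2 * r)) - r * Real.cosh (μ * (2 * r))) := by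
    constructor
    · simpa using hr
    · have h1 := one_add_sq_div_two_le_cosh (2 * r)
      have h2 : r ≤ Real.cosh (2 * r) := by nlinarith
      have h3 : 0 ≤ Real.sinh (2 * r) * Real.sinh (μ * (2 * r)) :=
        mul_nonneg (Real.sinh_nonneg_iff.2 (by positivity))
          (Real.sinh_nonneg_iff.2 (by positivity))
      have h4 := mul_le_mul_of_nonneg_right h2 (Real.cosh_pos (μ * (2 * r))).le
      rw [add_mul, one_mul, Real.cosh_add]
      linarith
  obtain ⟨s, hs, h⟩ := intermediate_value_Icc (by positivity : (0 : ℝ) ≤ 2 * r) hcont hmem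
  exact ⟨s, hs.1, sub_eq_zero.1 h⟩

/-- A Chebyshev-type correlation inequality for the weight `exp (-z cosh t)`. -/
theorem besselK_correlation {z μ : ℝ} (hz : 0 < z) (hμ : 0 ≤ μ) :
    besselK (μ + 1) z * (besselK (μ + 1) z + besselK (μ - 1) z) <
      besselK μ z * (besselK (μ + 2) z + besselK μ z) := by
  have hK := besselK_pos hz μ
  set r := besselK (μ + 1) z / besselK μ z with hr
  have hr1 : 1 ≤ r := ((one_lt_div hK).2 (besselK_lt_besselK_succ hz hμ)).le
  obtain ⟨s, hs, hsr⟩ := exists_cosh_succ_mul_eq hr1 hμ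
  have hpos : ∀ t, 0 < t → t ≠ s → 0 < Real.exp (-z * Real.cosh t) *
      ((Real.cosh t - Real.cosh s) *
        (Real.cosh ((μ + 1) * t) - r * Real.cosh (μ * t))) := fun t ht hts => by
    refine mul_pos (Real.exp_pos _) ?_
    have hcs := Real.cosh_pos (μ * s)
    rcases lt_or_gt_of_ne hts with h | h
    · have h1 := cosh_succ_mul_lt hμ ht.le h
      have h2 : Real.cosh t < Real.cosh s := by
        rwa [Real.cosh_lt_cosh, abs_of_pos ht, abs_of_nonneg hs]
      rw [hsr] at h1
      have h3 : Real.cosh ((μ + 1) * t) < r * Real.cosh (μ * t) := by nlinarith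
      exact mul_pos_of_neg_of_neg (by linarith) (by linarith)
    · have h1 := cosh_succ_mul_lt hμ hs h
      have h2 : Real.cosh s < Real.cosh t := by
        rwa [Real.cosh_lt_cosh, abs_of_pos ht, abs_of_nonneg hs]
      rw [hsr] at h1
      have h3 : r * Real.cosh (μ * t) < Real.cosh ((μ + 1) * t) := by nlinarith
      exact mul_pos (by linarith) (by linarith)
  have i1 := integrableOn_cosh_mul_besselK hz (μ + 1)
  have i2 := (integrableOn_cosh_mul_besselK hz μ).const_mul r
  have i3 := (integrableOn_besselK hz (μ + 1)).const_mul (Real.cosh s)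
  have i4 := (integrableOn_besselK hz μ).const_mul (Real.cosh s * r)
  have heq : ∀ t, Real.exp (-z * Real.cosh t) * ((Real.cosh t - Real.cosh s) *
        (Real.cosh ((μ + 1) * t) - r * Real.cosh (μ * t))) =
      (Real.exp (-z * Real.cosh t) * (Real.cosh t * Real.cosh ((μ + 1) * t)) -
        r * (Real.exp (-z * Real.cosh t) * (Real.cosh t * Real.cosh (μ * t)))) -
      (Real.cosh s * (Real.exp (-z * Real.cosh t) * Real.cosh ((μ + 1) * t)) -
        Real.cosh s * r * (Real.exp (-z * Real.cosh t) * Real.cosh (μ * t))) :=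
    fun t => by ring
  simp only [heq] at hpos
  have key := setIntegral_Ioi_pos (s := s) ((i1.sub i2).sub (i3.sub i4))
    (fun t ht => by
      rcases eq_or_ne t s with rfl | h
      · change 0 ≤ (_ - _ : ℝ) - (_ - _)
        rw [← heq]
        simp
      · exact (hpos t ht h).le) hpos
  rw [integral_sub' (i1.sub i2) (i3.sub i4), integral_sub' i1 i2, integral_sub' i3 i4,
    integral_const_mul, integral_const_mul, integral_const_mul,
    integral_cosh_mul_besselK hz, integral_cosh_mul_besselK hz] at key
  change 0 < _ - (Real.cosh s * besselK (μ + 1) z - Real.cosh s * r * besselK μ z) at key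
  have hrK : r * besselK μ z = besselK (μ + 1) z := div_mul_cancel₀ _ hK.ne'
  rw [mul_assoc, hrK, sub_self, sub_zero, add_sub_cancel_right,
    show μ + 1 + 1 = μ + 2 by ring] at key
  rw [← hrK] at key ⊢
  nlinarith

/-- The ratio of consecutive Bessel functions has negative derivative. -/
theorem besselK_ratio_riccati_neg {z μ : ℝ} (hz : 0 < z) (hμ : 0 ≤ μ) :
    (besselK (μ + 1) z / besselK μ z) ^ 2
        - (2 * μ + 1) / z * (besselK (μ + 1) z / besselK μ z) - 1 < 0 := by
  have hK := besselK_pos hz μ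
  have h1 := besselK_recurrence hz μ
  have h2 := besselK_recurrence hz (μ + 1)
  have h3 := besselK_correlation hz hμ
  rw [add_sub_cancel_right, show μ + 1 + 1 = μ + 2 by ring] at h2
  have e : (besselK (μ + 1) z / besselK μ z) ^ 2
        - (2 * μ + 1) / z * (besselK (μ + 1) z / besselK μ z) - 1 =
      (besselK (μ + 1) z * (besselK (μ + 1) z + besselK (μ - 1) z) -
        besselK μ z * (besselK (μ + 2) z + besselK μ z)) / (2 * besselK μ z ^ 2) := by
    field_simp
    linear_combination besselK (μ + 1) z * h1 + besselK μ z * h2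
  rw [e]
  exact div_neg_of_neg_of_pos (by linarith) (by positivity)

/-- The quantity `-z ^ 2 (K_{ν+1} / K_ν)'`, evaluated through the Riccati equation. -/
noncomputable def besselHeat (ν z : ℝ) : ℝ :=
  z ^ 2 + (2 * ν + 1) * (z * (besselK (ν + 1) z / besselK ν z))
    - (z * (besselK (ν + 1) z / besselK ν z)) ^ 2

theorem Hfun_eq_besselHeat (d : ℤ) {z : ℝ} (hz : 0 < z) :
    Hfun d z = besselHeat (((d : ℝ) + 1) / 2) z := by
  have hG : G d 1 = fun y =>
      besselK (((d : ℝ) + 1) / 2 + 1) y / besselK (((d : ℝ) + 1) / 2) y := by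
    funext y
    simp [G]
  rw [Hfun, hG, (hasDerivAt_besselK_ratio hz _).deriv, besselHeat]
  generalize besselK (((d : ℝ) + 1) / 2 + 1) z / besselK (((d : ℝ) + 1) / 2) z = g
  field_simp
  ring

theorem besselHeat_pos {z ν : ℝ} (hz : 0 < z) (hν : 0 ≤ ν) : 0 < besselHeat ν z := by
  have h := mul_pos (pow_pos hz 2) (neg_pos.2 (besselK_ratio_riccati_neg hz hν))
  have e : z ^ 2 * -((besselK (ν + 1) z / besselK ν z) ^ 2
        - (2 * ν + 1) / z * (besselK (ν + 1) z / besselK ν z) - 1) = besselHeat ν z := by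
    rw [besselHeat]
    generalize besselK (ν + 1) z / besselK ν z = g
    field_simp
    ring
  rwa [e] at h

theorem besselK_ratio_recurrence {z : ℝ} (hz : 0 < z) (ν : ℝ) :
    z * (besselK (ν + 1) z / besselK ν z) =
      2 * ν + z ^ 2 / (z * (besselK ν z / besselK (ν - 1) z)) := by
  have h := besselK_recurrence hz ν
  have h1 := besselK_pos hz ν
  have h2 := besselK_pos hz (ν - 1)
  field_simp
  linarith

theorem besselHeat_lt {z ν : ℝ} (hz : 0 < z) (hν : 1 ≤ ν) : besselHeat ν z < 2 * ν := by
  have h := besselHeat_pos (ν := ν - 1) hz (by linarith)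
  have h1 := besselK_ratio_recurrence hz ν
  rw [besselHeat, sub_add_cancel] at h
  rw [besselHeat, h1]
  have hy : 0 < z * (besselK ν z / besselK (ν - 1) z) :=
    mul_pos hz (div_pos (besselK_pos hz _) (besselK_pos hz _))
  generalize z * (besselK ν z / besselK (ν - 1) z) = y at h hy
  have e : 2 * ν - (z ^ 2 + (2 * ν + 1) * (2 * ν + z ^ 2 / y) - (2 * ν + z ^ 2 / y) ^ 2) =
      z ^ 2 * (z ^ 2 + (2 * (ν - 1) + 1) * y - y ^ 2) / y ^ 2 := by
    field_simp
    ring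
  have : 0 < z ^ 2 * (z ^ 2 + (2 * (ν - 1) + 1) * y - y ^ 2) / y ^ 2 := by positivity
  linarith

theorem add_half_lt_mul_besselK_ratio {z ν : ℝ} (hz : 0 < z) (hν : 1 ≤ ν) :
    ν + 1 / 2 < z * (besselK (ν + 1) z / besselK ν z) := by
  rw [besselK_ratio_recurrence hz ν]
  have hy : 0 < z * (besselK ν z / besselK (ν - 1) z) :=
    mul_pos hz (div_pos (besselK_pos hz _) (besselK_pos hz _))
  have : 0 < z ^ 2 / (z * (besselK ν z / besselK (ν - 1) z)) := by positivity
  linarith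

theorem hasDerivAt_besselHeat {z : ℝ} (hz : 0 < z) (ν : ℝ) :
    HasDerivAt (besselHeat ν)
      ((2 * (z * (besselK (ν + 1) z / besselK ν z) - (ν - 1 / 2)) *
        (besselHeat ν z - (ν + 1 / 2)) - 2 * (ν + 1 / 2) * (ν - 1 / 2)) / z) z := by
  have hx := (hasDerivAt_id z).mul (hasDerivAt_besselK_ratio hz ν)
  have h := (((hasDerivAt_id z).pow 2).add (hx.const_mul (2 * ν + 1))).sub (hx.pow 2)
  refine h.congr_deriv ?_
  simp only [besselHeat, Pi.mul_apply, id]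
  generalize besselK (ν + 1) z / besselK ν z = g
  field_simp
  ring

theorem lt_besselHeat {z ν : ℝ} (hz : 0 < z) (hν : 1 ≤ ν) : ν + 1 / 2 < besselHeat ν z := by
  by_contra! hle
  set a : ℝ := (ν + 1 / 2) * (ν - 1 / 2) with ha
  have ha0 : 0 < a := mul_pos (by linarith) (by linarith)
  have hbar : ∀ y, z ≤ y →
      besselHeat ν y - (ν + 1 / 2) ≤ -a * (Real.log y - Real.log z) := fun y hy => by
    have hpos : ∀ u ∈ Set.Icc z y, 0 < u := fun u hu => hz.trans_le hu.1
    refine image_le_of_deriv_right_lt_deriv_boundary' (a := z) (b := y)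
      (f := fun u => besselHeat ν u - (ν + 1 / 2))
      (B := fun u => -a * (Real.log u - Real.log z)) (B' := fun u => -a * u⁻¹)
      (fun u hu => ((hasDerivAt_besselHeat (hpos u hu) ν).sub_const
        (ν + 1 / 2)).continuousAt.continuousWithinAt)
      (fun u hu => ((hasDerivAt_besselHeat (hpos u (Set.Ico_subset_Icc_self hu)) ν).sub_const
        (ν + 1 / 2)).hasDerivWithinAt)
      (by simpa using hle)
      (fun u hu => ((((Real.hasDerivAt_log (hpos u hu).ne').sub_const
        (Real.log z)).const_mul (-a))).continuousAt.continuousWithinAt)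
      (fun u hu => ((((Real.hasDerivAt_log (hpos u (Set.Ico_subset_Icc_self hu)).ne').sub_const
        (Real.log z)).const_mul (-a))).hasDerivWithinAt)
      (fun u hu heq => ?_) ⟨hy, le_rfl⟩
    have hu0 := hpos u (Set.Ico_subset_Icc_self hu)
    have hlog : Real.log z ≤ Real.log u := Real.log_le_log hz hu.1
    have hneg : besselHeat ν u - (ν + 1 / 2) ≤ 0 := by
      rw [heq]
      nlinarith
    have hx := add_half_lt_mul_besselK_ratio hu0 hν
    rw [← div_eq_mul_inv, div_lt_div_iff_of_pos_right hu0]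
    nlinarith
  have hlog : Tendsto (fun y => Real.log y) atTop atTop := Real.tendsto_log_atTop
  obtain ⟨y, hy1, hy2⟩ := ((hlog.eventually_ge_atTop
    (Real.log z + (ν + 1 / 2) / a)).and (eventually_ge_atTop z)).exists
  have h1 := hbar y hy2
  have h2 := besselHeat_pos (ν := ν) (hz.trans_le hy2) (by linarith)
  have h3 : a * ((ν + 1 / 2) / a) ≤ a * (Real.log y - Real.log z) :=
    mul_le_mul_of_nonneg_left (by linarith) ha0.le
  rw [mul_div_cancel₀ _ ha0.ne'] at h3
  linarith

/-- Bounds on the heat capacities: `d/2 + 1 < H(z) = c_p/k_B < d + 1` and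
`d/2 < H(z) − 1 = c_v/k_B < d` for every `z > 0`. -/
theorem Hfun_bounds (d : ℤ) (hd : 2 ≤ d) (z : ℝ) (hz : 0 < z) :
    ((d : ℝ) / 2 + 1 < Hfun d z ∧ Hfun d z < (d : ℝ) + 1) ∧
    ((d : ℝ) / 2 < Hfun d z - 1 ∧ Hfun d z - 1 < (d : ℝ)) := by
  have hd' : (2 : ℝ) ≤ d := by exact_mod_cast hd
  have hν : 1 ≤ ((d : ℝ) + 1) / 2 := by linarith
  have h1 := lt_besselHeat hz hν
  have h2 := besselHeat_lt hz hν
  rw [← Hfun_eq_besselHeat d hz] at h1 h2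
  refine ⟨⟨?_, ?_⟩, ?_, ?_⟩ <;> linarith
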